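/- Let d ≥ 3 and let p ∈ ℝ[x,y] be a binary form of degree d that is a product of d pairwise non-proportional real linear forms, and assume that the complex Waring rank of p, viewed as an element of ℂ[x,y], equals ⌈(d+1)/2⌉. Then: (i) for every homogeneous F ∈ ℂ[x,y] of degree d with F ∉ ℂ·p there exists μ ∈ ℂ such that rank_ℂ(F + μ·p) ≤ ⌈(d+1)/2⌉ (so the maximal complex rank with respect to the projection of the rational normal curve from p is at most ⌈(d+1)/2⌉); and (ii) there exists a binary form q of degree d with q ∉ ℝ·p such that rank_ℝ(q + μ·p) = d for every μ ∈ ℝ (so the maximal real rank with respect to this projection is d). -/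

import Mathlib

open scoped BigOperators
open MvPolynomial

/-- The real Waring rank of a binary form `f` of degree `d`: the least `r : ℕ∞` such that
`f = ∑ λᵢ ℓᵢ^d` for real numbers `λᵢ` and real linear forms `ℓᵢ` (`∞` if none exists). -/
noncomputable def waringRank (d : ℕ) (f : MvPolynomial (Fin 2) ℝ) : ℕ∞ :=
  sInf ((fun n : ℕ => (n : ℕ∞)) ''
    {r : ℕ | ∃ lam : Fin r → ℝ, ∃ l : Fin r → ℝ × ℝ,
      f = ∑ i, C (lam i) * (C (l i).1 * X 0 + C (l i).2 * X 1) ^ d})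

/-- The complex Waring rank of a binary form `F ∈ ℂ[x,y]` of degree `d`: the least `r : ℕ∞`
such that `F = ℓ₁^d + ⋯ + ℓ_r^d` for complex linear forms `ℓᵢ` (`∞` if none exists). -/
noncomputable def cWaringRank (d : ℕ) (F : MvPolynomial (Fin 2) ℂ) : ℕ∞ :=
  sInf ((fun n : ℕ => (n : ℕ∞)) ''
    {r : ℕ | ∃ l : Fin r → ℂ × ℂ,
      F = ∑ i, (C (l i).1 * X 0 + C (l i).2 * X 1) ^ d})

theorem exists_finset_deriv_eq_zero {F F' : ℝ → ℝ} (hF : ∀ x, HasDerivAt F (F' x) x)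
    (T : Finset ℝ) (hT : ∀ t ∈ T, F t = 0) :
    ∃ U : Finset ℝ, T.card ≤ U.card + 1 ∧
      ∀ u ∈ U, F' u = 0 ∧ (∃ t ∈ T, t < u) ∧ ∃ t ∈ T, u < t := by
  obtain h0 | ⟨n, hn⟩ : T.card = 0 ∨ ∃ n, T.card = n + 1 := by
    cases h : T.card with
    | zero => exact Or.inl rfl
    | succ n => exact Or.inr ⟨n, rfl⟩
  · exact ⟨∅, by simp [h0], by simp⟩
  have hmem : ∀ i, T.orderEmbOfFin hn i ∈ T := T.orderEmbOfFin_mem hn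
  have hstep : ∀ i : Fin n, ∃ u, T.orderEmbOfFin hn i.castSucc < u ∧
      u < T.orderEmbOfFin hn i.succ ∧ F' u = 0 := by
    intro i
    have hlt : T.orderEmbOfFin hn i.castSucc < T.orderEmbOfFin hn i.succ := by
      simp
    obtain ⟨u, hu, hu'⟩ := exists_hasDerivAt_eq_zero hlt
      (fun x _ => (hF x).continuousAt.continuousWithinAt)
      ((hT _ (hmem _)).trans (hT _ (hmem _)).symm) (fun x _ => hF x)
    exact ⟨u, hu.1, hu.2, hu'⟩
  choose s hs1 hs2 hs3 using hstep
  have hmono : StrictMono s := by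
    intro i j hij
    refine (hs2 i).trans_le (le_trans ?_ (hs1 j).le)
    simpa using hij
  refine ⟨Finset.univ.image s, ?_, ?_⟩
  · rw [Finset.card_image_of_injective _ hmono.injective, hn]; simp
  · intro u hu
    obtain ⟨i, -, rfl⟩ := Finset.mem_image.1 hu
    exact ⟨hs3 i, ⟨_, hmem _, hs1 i⟩, ⟨_, hmem _, hs2 i⟩⟩

/-- Zero-counting step: the case in which the first linear form is a multiple of `y`. -/
theorem powerSum_eq_zero_of_head_eq_zero {r e : ℕ} (hre : r < e)
    (ih : ∀ (lam a b : Fin r → ℝ) (S : Finset (ℝ × ℝ)), e ≤ S.card →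
      (∀ v ∈ S, ∀ w ∈ S, v ≠ w → v.1 * w.2 - v.2 * w.1 ≠ 0) →
      (∀ v ∈ S, ∑ i, lam i * (a i * v.1 + b i * v.2) ^ e = 0) →
      ∀ x y, ∑ i, lam i * (a i * x + b i * y) ^ e = 0)
    (lam a b : Fin (r + 1) → ℝ) (ha : a 0 = 0) (S : Finset (ℝ × ℝ)) (hS : e + 1 ≤ S.card)
    (hind : ∀ v ∈ S, ∀ w ∈ S, v ≠ w → v.1 * w.2 - v.2 * w.1 ≠ 0)
    (hz : ∀ v ∈ S, ∑ i, lam i * (a i * v.1 + b i * v.2) ^ (e + 1) = 0) (x y : ℝ) :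
    ∑ i, lam i * (a i * x + b i * y) ^ (e + 1) = 0 := by
  classical
  have hder : ∀ y x, HasDerivAt (fun x => ∑ i, lam i * (a i * x + b i * y) ^ (e + 1))
      ((e + 1) * ∑ i : Fin r, (lam i.succ * a i.succ) *
        (a i.succ * x + b i.succ * y) ^ e) x := by
    intro y x
    have h := HasDerivAt.fun_sum (u := Finset.univ) fun (i : Fin (r + 1)) _ =>
      ((((hasDerivAt_id x).const_mul (a i)).add_const (b i * y)).pow (e + 1)).const_mul (lam i)
    refine h.congr_deriv ?_
    rw [Fin.sum_univ_succ]
    simp only [id, ha, Finset.mul_sum, zero_mul, mul_zero, zero_add, add_tsub_cancel_right]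
    refine Finset.sum_congr rfl fun i _ => ?_
    push_cast
    ring
  set S' := S.filter (fun v => v.2 ≠ 0) with hS'
  set T := S'.image (fun v => v.1 / v.2) with hTdef
  have hcardT : T.card = S'.card := by
    refine Finset.card_image_of_injOn ?_
    intro v hv w hw hvw
    simp only [hS', Finset.coe_filter, Set.mem_ofPred_eq] at hv hw
    by_contra hne
    apply hind v hv.1 w hw.1 hne
    have h1 := hv.2
    have h2 := hw.2
    simp only at hvw
    rw [div_eq_div_iff h1 h2] at hvw
    linarith
  have hT : ∀ t ∈ T, ∑ i, lam i * (a i * t + b i * 1) ^ (e + 1) = 0 := by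
    intro t ht
    obtain ⟨v, hv, rfl⟩ := Finset.mem_image.1 ht
    obtain ⟨hvS, hv2⟩ := Finset.mem_filter.1 hv
    have h := hz v hvS
    have : ∑ i, lam i * (a i * v.1 + b i * v.2) ^ (e + 1) =
        v.2 ^ (e + 1) * ∑ i, lam i * (a i * (v.1 / v.2) + b i * 1) ^ (e + 1) := by
      rw [Finset.mul_sum]
      refine Finset.sum_congr rfl fun i _ => ?_
      rw [mul_left_comm, ← mul_pow]
      congr 2
      field_simp
    rw [this] at h
    exact (mul_eq_zero.1 h).resolve_left (pow_ne_zero _ hv2)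
  obtain ⟨U, hU, hU'⟩ := exists_finset_deriv_eq_zero (hder 1) T hT
  have he1 : ((e : ℝ) + 1) ≠ 0 := by positivity
  have hzero : ∀ x y, ∑ i : Fin r, (lam i.succ * a i.succ) *
        (a i.succ * x + b i.succ * y) ^ e = 0 := by
    have hUmem : ∀ v ∈ U.image (fun u => (u, (1 : ℝ))), ∑ i : Fin r, (lam i.succ * a i.succ) *
        (a i.succ * v.1 + b i.succ * v.2) ^ e = 0 := by
      intro v hv
      obtain ⟨u, hu, rfl⟩ := Finset.mem_image.1 hv
      exact (mul_eq_zero.1 (hU' u hu).1).resolve_left he1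
    have hUcard : (U.image (fun u => (u, (1 : ℝ)))).card = U.card :=
      Finset.card_image_of_injective _ fun u v h => by simpa using h
    by_cases hall : ∀ v ∈ S, v.2 ≠ 0
    · refine ih _ _ _ (U.image fun u => (u, 1)) ?_ ?_ hUmem
      · rw [Finset.filter_true_of_mem hall] at hS'
        rw [hUcard]; rw [hS'] at hcardT; omega
      · intro v hv w hw hvw
        obtain ⟨u, hu, rfl⟩ := Finset.mem_image.1 hv
        obtain ⟨u', hu', rfl⟩ := Finset.mem_image.1 hw
        intro h
        apply hvw
        simp only [mul_one, one_mul, sub_eq_zero] at h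
        rw [h]
    · push Not at hall
      obtain ⟨v₀, hv₀, hv₀2⟩ := hall
      have hS'c : S.card ≤ S'.card + 1 := by
        have : S ⊆ insert v₀ S' := by
          intro v hv
          rw [Finset.mem_insert]
          by_contra hcon
          push Not at hcon
          have h2 : v.2 = 0 := by
            by_contra h2
            exact hcon.2 (Finset.mem_filter.2 ⟨hv, h2⟩)
          exact hind v hv v₀ hv₀ hcon.1 (by simp [h2, hv₀2])
        exact (Finset.card_le_card this).trans (Finset.card_insert_le _ _)
      have hv₀1 : v₀.1 ≠ 0 := by
        intro h
        obtain ⟨w, hw, hne⟩ := Finset.exists_mem_ne (show 1 < S.card by omega) v₀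
        exact hind w hw v₀ hv₀ hne (by simp [h, hv₀2])
      have hnot : ((1 : ℝ), (0 : ℝ)) ∉ U.image (fun u => (u, (1 : ℝ))) := by simp
      refine ih _ _ _ (insert (1, 0) (U.image fun u => (u, 1))) ?_ ?_ ?_
      · rw [Finset.card_insert_of_notMem hnot, hUcard]; omega
      · intro v hv w hw hvw
        rw [Finset.mem_insert] at hv hw
        rcases hv with rfl | hv <;> rcases hw with rfl | hw
        · exact absurd rfl hvw
        · obtain ⟨u', hu', rfl⟩ := Finset.mem_image.1 hw
          simp
        · obtain ⟨u', hu', rfl⟩ := Finset.mem_image.1 hv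
          simp
        · obtain ⟨u, hu, rfl⟩ := Finset.mem_image.1 hv
          obtain ⟨u', hu', rfl⟩ := Finset.mem_image.1 hw
          intro h
          apply hvw
          simp only [mul_one, one_mul, sub_eq_zero] at h
          rw [h]
      · intro v hv
        rw [Finset.mem_insert] at hv
        rcases hv with rfl | hv
        · have h := hz v₀ hv₀
          rw [Fin.sum_univ_succ] at h
          simp only [ha, hv₀2, mul_zero, add_zero, zero_mul, mul_pow] at h
          rw [zero_pow (by omega), mul_zero, zero_add] at h
          simp only [mul_one, mul_zero, add_zero]
          have h' : v₀.1 ^ (e + 1) *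
              ∑ i : Fin r, lam i.succ * a i.succ * a i.succ ^ e = 0 := by
            rw [← h, Finset.mul_sum]
            refine Finset.sum_congr rfl fun i _ => ?_
            ring
          exact (mul_eq_zero.1 h').resolve_left (pow_ne_zero _ hv₀1)
        · exact hUmem v hv
  have hconst : ∀ x y, ∑ i, lam i * (a i * x + b i * y) ^ (e + 1) =
      y ^ (e + 1) * ∑ i, lam i * b i ^ (e + 1) := by
    intro x y
    have h := is_const_of_deriv_eq_zero (fun x => (hder y x).differentiableAt)
      (fun x => by rw [(hder y x).deriv, hzero, mul_zero]) x 0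
    rw [h, Finset.mul_sum]
    refine Finset.sum_congr rfl fun i _ => ?_
    ring
  have hone : 1 < S.card := by omega
  obtain ⟨v, hv, w, hw, hvw⟩ := Finset.one_lt_card.1 hone
  have hc := hind v hv w hw hvw
  have hB : ∑ i, lam i * b i ^ (e + 1) = 0 := by
    have h1 := hz v hv
    have h2 := hz w hw
    rw [hconst] at h1 h2
    rcases mul_eq_zero.1 h1 with h1 | h1
    · rcases mul_eq_zero.1 h2 with h2 | h2
      · rw [pow_eq_zero_iff (by omega)] at h1 h2
        simp [h1, h2] at hc
      · exact h2
    · exact h1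
  rw [hconst, hB, mul_zero]

/-- A combination of `r` real `e`-th powers of linear forms with `r < e` that has `e` pairwise
non-proportional real zeros vanishes identically. -/
theorem powerSum_eq_zero {r e : ℕ} (hre : r < e) (lam a b : Fin r → ℝ) (S : Finset (ℝ × ℝ))
    (hS : e ≤ S.card) (hind : ∀ v ∈ S, ∀ w ∈ S, v ≠ w → v.1 * w.2 - v.2 * w.1 ≠ 0)
    (hz : ∀ v ∈ S, ∑ i, lam i * (a i * v.1 + b i * v.2) ^ e = 0) (x y : ℝ) :
    ∑ i, lam i * (a i * x + b i * y) ^ e = 0 := by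
  classical
  induction r generalizing e S x y with
  | zero => simp
  | succ r ih =>
    obtain ⟨e, rfl⟩ : ∃ k, e = k + 1 := ⟨e - 1, by omega⟩
    by_cases h0 : a 0 ^ 2 + b 0 ^ 2 = 0
    · have ha0 : a 0 = 0 := by nlinarith [sq_nonneg (a 0), sq_nonneg (b 0)]
      have hb0 : b 0 = 0 := by nlinarith [sq_nonneg (a 0), sq_nonneg (b 0)]
      simp only [Fin.sum_univ_succ, ha0, hb0, zero_mul, add_zero, ne_eq, Nat.add_eq_zero_iff,
        one_ne_zero, and_false, not_false_eq_true, zero_pow, mul_zero, zero_add] at hz ⊢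
      exact ih (by omega) _ _ _ S hS hind hz x y
    · set N := a 0 ^ 2 + b 0 ^ 2 with hN
      set φ : ℝ × ℝ → ℝ × ℝ :=
        fun v => (v.1 * b 0 - v.2 * a 0, v.1 * a 0 + v.2 * b 0) with hφ
      have hdet : ∀ v w, (φ v).1 * (φ w).2 - (φ v).2 * (φ w).1 =
          N * (v.1 * w.2 - v.2 * w.1) := by
        intro v w; simp only [hφ, hN]; ring
      have hval : ∀ v, ∑ i, lam i * ((a i * b 0 - b i * a 0) * (φ v).1 +
          (a i * a 0 + b i * b 0) * (φ v).2) ^ (e + 1) =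
          N ^ (e + 1) * ∑ i, lam i * (a i * v.1 + b i * v.2) ^ (e + 1) := by
        intro v
        rw [Finset.mul_sum]
        refine Finset.sum_congr rfl fun i _ => ?_
        rw [mul_left_comm, ← mul_pow]
        congr 2
        simp only [hφ, hN]; ring
      have hinj : Set.InjOn φ S := by
        intro v hv w hw hvw
        by_contra hne
        apply mul_ne_zero h0 (hind v hv w hw hne)
        rw [← hdet, hvw]; ring
      have hstep := powerSum_eq_zero_of_head_eq_zero (r := r) (e := e) (by omega)
        (fun lam a b S hS hind hz x y => ih (by omega) lam a b S hS hind hz x y)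
        lam (fun i => a i * b 0 - b i * a 0) (fun i => a i * a 0 + b i * b 0) (by ring)
        (S.image φ) (by rwa [Finset.card_image_of_injOn hinj])
        (by
          intro v hv w hw hvw
          obtain ⟨v, hvS, rfl⟩ := Finset.mem_image.1 hv
          obtain ⟨w, hwS, rfl⟩ := Finset.mem_image.1 hw
          rw [hdet]
          exact mul_ne_zero h0 (hind v hvS w hwS fun h => hvw (by rw [h])))
        (by
          intro v hv
          obtain ⟨v, hvS, rfl⟩ := Finset.mem_image.1 hv
          rw [hval, hz v hvS, mul_zero])
        (φ (x, y)).1 (φ (x, y)).2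
      rw [hval] at hstep
      exact (mul_eq_zero.1 hstep).resolve_left (pow_ne_zero _ h0)

theorem exists_eval_eq_sum_choose {K : Type*} [Field K] [CharZero K] {d : ℕ}
    {f : MvPolynomial (Fin 2) K} (hf : f.IsHomogeneous d) :
    ∃ c : ℕ → K, ∀ v : Fin 2 → K,
      eval v f = ∑ j ∈ Finset.range (d + 1), c j * (d.choose j * (v 0 ^ j * v 1 ^ (d - j))) := by
  refine ⟨fun j => coeff (Finsupp.single 0 j + Finsupp.single 1 (d - j)) f / d.choose j,
    fun v => ?_⟩
  have hdeg : ∀ m ∈ f.support, m 0 + m 1 = d := by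
    intro m hm
    have := hf (mem_support_iff.1 hm)
    rw [Finsupp.weight_apply, Finsupp.sum_fintype] at this
    · simpa using this
    · simp
  have hrec : ∀ m ∈ f.support, m = Finsupp.single 0 (m 0) + Finsupp.single 1 (d - m 0) := by
    intro m hm
    have := hdeg m hm
    ext i
    fin_cases i
    · simp
    · simp
      omega
  rw [eval_eq']
  refine Finset.sum_of_injOn (fun m => m 0) ?_ ?_ ?_ ?_
  · intro m hm m' hm' h
    rw [hrec m hm, hrec m' hm']
    simp only at h
    rw [h]
  · intro m hm
    have := hdeg m hm
    simp only [Finset.coe_range, Set.mem_Iio]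
    omega
  · intro j hj hj'
    have : coeff (Finsupp.single 0 j + Finsupp.single 1 (d - j)) f = 0 := by
      by_contra hne
      exact hj' ⟨_, mem_support_iff.2 hne, by simp⟩
    simp only [this, zero_div, zero_mul]
  · intro m hm
    have h1 := hdeg m hm
    have h2 : ((d.choose (m 0) : ℕ) : K) ≠ 0 := by
      exact_mod_cast (Nat.choose_pos (by omega)).ne'
    have h3 : coeff (Finsupp.single 0 (m 0) + Finsupp.single 1 (d - m 0)) f = coeff m f := by
      rw [← hrec m hm]
    simp only [h3, Fin.prod_univ_two]
    rw [show d - m 0 = m 1 by omega]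
    field_simp

theorem eval_linear_pow {K : Type*} [Field K] (d : ℕ) (a b : K) (v : Fin 2 → K) :
    eval v ((C a * X 0 + C b * X 1) ^ d) =
      ∑ j ∈ Finset.range (d + 1), a ^ j * b ^ (d - j) *
        (d.choose j * (v 0 ^ j * v 1 ^ (d - j))) := by
  simp only [map_pow, map_add, map_mul, eval_C, eval_X]
  rw [add_pow]
  refine Finset.sum_congr rfl fun j _ => ?_
  rw [mul_pow, mul_pow]
  ring

theorem continuous_coeff_prod_X_sub_C {ι : Type*} {Y : Type*} [TopologicalSpace Y] (s : Finset ι)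
    {g : ι → Y → ℝ} (hg : ∀ i, Continuous (g i)) (n : ℕ) :
    Continuous fun y => (∏ i ∈ s, (Polynomial.X - Polynomial.C (g i y))).coeff n := by
  classical
  induction s using Finset.induction_on generalizing n with
  | empty => simpa using continuous_const
  | insert i s hi ih =>
    simp only [Finset.prod_insert hi, sub_mul, Polynomial.coeff_sub, Polynomial.coeff_C_mul]
    refine Continuous.sub ?_ ((hg i).mul (ih n))
    cases n with
    | zero => simpa using continuous_const
    | succ n => simpa [Polynomial.coeff_X_mul] using ih n

theorem exists_powerSum_of_apolar {d : ℕ} (c : ℕ → ℝ) {a : Fin d → ℝ}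
    (ha : Function.Injective a)
    (hc : ∑ j ∈ Finset.range (d + 1),
      c j * (∏ i, (Polynomial.X - Polynomial.C (a i))).coeff j = 0) :
    ∃ lam : Fin d → ℝ, ∀ j ∈ Finset.range (d + 1), ∑ i, lam i * a i ^ j = c j := by
  set V := Matrix.vandermonde a with hV
  have hdet : IsUnit V.det := (Matrix.det_vandermonde_ne_zero_iff.2 ha).isUnit
  set lam := Matrix.vecMul (fun j : Fin d => c j) V⁻¹ with hlam
  have hlt : ∀ j < d, ∑ i, lam i * a i ^ j = c j := by
    intro j hj
    have h : Matrix.vecMul lam V = fun j : Fin d => c j := by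
      rw [hlam, Matrix.vecMul_vecMul, Matrix.nonsing_inv_mul _ hdet, Matrix.vecMul_one]
    simpa [Matrix.vecMul, dotProduct, hV, Matrix.vandermonde_apply] using congrFun h ⟨j, hj⟩
  refine ⟨lam, fun j hj => ?_⟩
  rcases Nat.lt_succ_iff_lt_or_eq.1 (Finset.mem_range.1 hj) with hj | rfl
  · exact hlt j hj
  set g := ∏ i, (Polynomial.X - Polynomial.C (a i)) with hg
  have hmonic : g.Monic := Polynomial.monic_prod_X_sub_C _ _
  have hdeg : g.natDegree = j := by
    simp [hg, Polynomial.natDegree_finsetProd_X_sub_C_eq_card]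
  have hroot : ∀ i, ∑ k ∈ Finset.range (j + 1), g.coeff k * a i ^ k = 0 := by
    intro i
    rw [← hdeg, ← Polynomial.eval_eq_sum_range, hg, Polynomial.eval_prod]
    exact Finset.prod_eq_zero (Finset.mem_univ i) (by simp)
  have hsum : ∑ k ∈ Finset.range (j + 1), g.coeff k * ∑ i, lam i * a i ^ k = 0 := by
    simp only [Finset.mul_sum]
    rw [Finset.sum_comm]
    refine Finset.sum_eq_zero fun i _ => ?_
    rw [← mul_zero (lam i), ← hroot i, Finset.mul_sum]
    exact Finset.sum_congr rfl fun k _ => by ring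
  rw [Finset.sum_range_succ] at hsum hc
  have hlead : g.coeff j = 1 := by rw [← hdeg]; exact hmonic
  have heq : ∑ k ∈ Finset.range j, g.coeff k * ∑ i, lam i * a i ^ k =
      ∑ k ∈ Finset.range j, c k * g.coeff k :=
    Finset.sum_congr rfl fun k hk => by rw [hlt k (Finset.mem_range.1 hk)]; ring
  rw [hlead] at hsum hc
  linarith

theorem waringRank_le_of_indefinite {d : ℕ} {f : MvPolynomial (Fin 2) ℝ}
    (hf : f.IsHomogeneous d) {s t : ℝ} (hs : 0 < eval ![1, s] f) (ht : eval ![1, t] f < 0) :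
    waringRank d f ≤ d := by
  obtain ⟨c, hc⟩ := exists_eval_eq_sum_choose hf
  set H : ℝ × ℝ → ℝ := fun z => ∑ j ∈ Finset.range (d + 1),
    c j * (∏ i : Fin d, (Polynomial.X - Polynomial.C (z.1 + i * z.2))).coeff j with hH
  have hcont : Continuous H := by
    refine continuous_finsetSum _ fun j _ => continuous_const.mul ?_
    exact continuous_coeff_prod_X_sub_C _ (fun i => by fun_prop) j
  have hH0 : ∀ s, H (-s, 0) = eval ![1, s] f := by
    intro s
    rw [hc]
    refine Finset.sum_congr rfl fun j _ => ?_
    simp only [mul_zero, add_zero, Finset.prod_const, Finset.card_univ, Fintype.card_fin,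
      Polynomial.C_neg, sub_neg_eq_add, Polynomial.coeff_X_add_C_pow]
    simp [mul_comm]
  have hev : ∀ᶠ ε in nhdsWithin (0 : ℝ) {0}ᶜ, 0 < H (-s, ε) ∧ H (-t, ε) < 0 := by
    have h1 : Continuous fun ε => H (-s, ε) := by fun_prop
    have h2 : Continuous fun ε => H (-t, ε) := by fun_prop
    exact Filter.Eventually.filter_mono nhdsWithin_le_nhds <|
      ((h1.tendsto 0).eventually_const_lt (by rwa [hH0])).and
        ((h2.tendsto 0).eventually_lt_const (by rwa [hH0]))
  obtain ⟨ε, ⟨h1, h2⟩, hε⟩ := (hev.and self_mem_nhdsWithin).exists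
  obtain ⟨u, hu⟩ := mem_range_of_exists_le_of_exists_ge
    (f := fun u => H (u, ε)) (c := 0) (by fun_prop) ⟨_, h2.le⟩ ⟨_, h1.le⟩
  have hinj : Function.Injective fun i : Fin d => u + i * ε := by
    intro i j hij
    have hε' : ε ≠ 0 := hε
    simpa [hε', Fin.val_inj] using hij
  obtain ⟨lam, hlam⟩ := exists_powerSum_of_apolar c hinj hu
  refine sInf_le ⟨d, ⟨lam, fun i => (u + i * ε, 1), ?_⟩, rfl⟩
  refine MvPolynomial.funext fun v => ?_
  rw [hc, map_sum]
  simp only [map_mul (eval v) (C _), eval_C, eval_linear_pow]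
  simp only [Finset.mul_sum]
  rw [Finset.sum_comm]
  refine Finset.sum_congr rfl fun j hj => ?_
  rw [← hlam j hj, Finset.sum_mul]
  refine Finset.sum_congr rfl fun i _ => ?_
  simp only [one_pow]
  ring

theorem cWaringRank_le_card {ι : Type*} {d : ℕ} (s : Finset ι) (l : ι → ℂ × ℂ)
    {F : MvPolynomial (Fin 2) ℂ}
    (hF : F = ∑ i ∈ s, (C (l i).1 * X 0 + C (l i).2 * X 1) ^ d) :
    cWaringRank d F ≤ s.card := by
  refine sInf_le ⟨s.card, ⟨fun k => l (s.equivFin.symm k), ?_⟩, rfl⟩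
  rw [hF, ← Finset.sum_coe_sort]
  exact (Equiv.sum_comp s.equivFin.symm
    (fun i : s => (C (l i).1 * X 0 + C (l i).2 * X 1) ^ d)).symm

theorem exists_of_cWaringRank_eq {d r : ℕ} {F : MvPolynomial (Fin 2) ℂ}
    (h : cWaringRank d F = r) :
    ∃ l : Fin r → ℂ × ℂ, F = ∑ i, (C (l i).1 * X 0 + C (l i).2 * X 1) ^ d := by
  have hne : ((fun n : ℕ => (n : ℕ∞)) '' {r : ℕ | ∃ l : Fin r → ℂ × ℂ,
      F = ∑ i, (C (l i).1 * X 0 + C (l i).2 * X 1) ^ d}).Nonempty := by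
    by_contra hne
    rw [Set.not_nonempty_iff_eq_empty] at hne
    rw [cWaringRank, hne, sInf_empty] at h
    exact ENat.top_ne_natCast _ h
  obtain ⟨n, hn, hn'⟩ := csInf_mem hne
  have : n = r := by
    have : (n : ℕ∞) = r := hn'.trans h
    exact_mod_cast this
  subst this
  exact hn

/-- In a decomposition of minimal length the linear forms are pairwise non-proportional. -/
theorem cross_ne_zero_of_cWaringRank_eq {d r : ℕ} (hd : d ≠ 0) {F : MvPolynomial (Fin 2) ℂ}
    (h : cWaringRank d F = r) {l : Fin r → ℂ × ℂ}
    (hF : F = ∑ i, (C (l i).1 * X 0 + C (l i).2 * X 1) ^ d) {i j : Fin r} (hij : i ≠ j) :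
    (l i).1 * (l j).2 - (l i).2 * (l j).1 ≠ 0 := by
  classical
  intro hcross
  obtain ⟨m, hm⟩ : ∃ m : ℂ × ℂ,
      (C (l i).1 * X 0 + C (l i).2 * X 1) ^ d + (C (l j).1 * X 0 + C (l j).2 * X 1) ^ d =
        ((C m.1 * X 0 + C m.2 * X 1) ^ d : MvPolynomial (Fin 2) ℂ) := by
    by_cases hj : l j = 0
    · exact ⟨l i, by simp [hj, hd]⟩
    · obtain ⟨t, ht⟩ : ∃ t : ℂ, l i = t • l j := by
        by_cases h1 : (l j).1 = 0
        · have h2 : (l j).2 ≠ 0 := fun h2 => hj (Prod.ext h1 h2)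
          refine ⟨(l i).2 / (l j).2, Prod.ext ?_ ?_⟩
          · simp only [h1, mul_zero, sub_zero, mul_eq_zero, h2, or_false] at hcross
            simp [h1, hcross]
          · simp [h2]
        · refine ⟨(l i).1 / (l j).1, Prod.ext ?_ ?_⟩
          · simp [h1]
          · simp only [Prod.smul_snd, smul_eq_mul]
            field_simp
            linear_combination -hcross
      obtain ⟨γ, hγ⟩ := IsAlgClosed.exists_pow_nat_eq (t ^ d + 1) (Nat.pos_of_ne_zero hd)
      refine ⟨γ • l j, ?_⟩
      have e1 : ∀ s : ℂ, (C (s • l j).1 * X 0 + C (s • l j).2 * X 1 :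
          MvPolynomial (Fin 2) ℂ) = C s * (C (l j).1 * X 0 + C (l j).2 * X 1) := by
        intro s; simp only [Prod.smul_fst, Prod.smul_snd, smul_eq_mul, C_mul]; ring
      rw [ht, e1, e1, mul_pow, mul_pow, ← C_pow, ← C_pow, hγ, C_add, C_1]
      ring
  have hle := cWaringRank_le_card (d := d) (Finset.univ.erase j) (Function.update l i m)
    (F := F) (by
    have hi : i ∈ Finset.univ.erase j := Finset.mem_erase.2 ⟨hij, Finset.mem_univ _⟩
    rw [hF, ← Finset.sum_erase_add _ _ (Finset.mem_univ j), ← Finset.sum_erase_add _ _ hi,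
      ← Finset.sum_erase_add _ _ hi, add_assoc, hm, Function.update_self]
    congr 1
    refine Finset.sum_congr rfl fun k hk => ?_
    rw [Function.update_of_ne (Finset.ne_of_mem_erase hk)])
  rw [h, Finset.card_erase_of_mem (Finset.mem_univ _), Finset.card_univ, Fintype.card_fin] at hle
  have hle' : r ≤ r - 1 := by exact_mod_cast hle
  have := i.pos
  omega

theorem two_mul_card_le_natDegree {P : Polynomial ℂ} (hP : P ≠ 0) (T : Finset ℂ)
    (h0 : ∀ t ∈ T, P.eval t = 0) (h1 : ∀ t ∈ T, P.derivative.eval t = 0) :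
    2 * T.card ≤ P.natDegree := by
  classical
  have hle : 2 • T.val ≤ P.roots := by
    rw [Multiset.le_iff_count]
    intro t
    rw [Multiset.count_nsmul, Polynomial.count_roots]
    by_cases ht : t ∈ T
    · rw [Multiset.count_eq_one_of_mem T.nodup ht]
      exact (Polynomial.one_lt_rootMultiplicity_iff_isRoot hP).2 ⟨h0 t ht, h1 t ht⟩
    · rw [Multiset.count_eq_zero_of_notMem ht]
      simp
  have := (Multiset.card_le_card hle).trans P.card_roots'
  simpa using this

/-- A binary form of degree `d` that is singular at `r` distinct points of the projective line,
where `d < 2 * r`, vanishes. -/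
theorem eq_zero_of_singular {d r : ℕ} (hd : 2 ≤ d) (hr : d < 2 * r) (l : Fin r → ℂ × ℂ)
    (hl0 : ∀ i, l i ≠ 0)
    (hl : ∀ i j, i ≠ j → (l i).1 * (l j).2 - (l i).2 * (l j).1 ≠ 0) (c : ℕ → ℂ)
    (h1 : ∀ i, ∑ j ∈ Finset.range (d + 1),
      c j * (j * (l i).1 ^ (j - 1) * (l i).2 ^ (d - j)) = 0)
    (h2 : ∀ i, ∑ j ∈ Finset.range (d + 1),
      c j * ((l i).1 ^ j * ((d - j : ℕ) * (l i).2 ^ (d - j - 1))) = 0) :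
    ∀ j ∈ Finset.range (d + 1), c j = 0 := by
  classical
  set P : Polynomial ℂ := ∑ j ∈ Finset.range (d + 1), Polynomial.monomial j (c j) with hP
  have hcoeff : ∀ k, P.coeff k = if k ∈ Finset.range (d + 1) then c k else 0 := by
    intro k
    simp [hP, Polynomial.finsetSum_coeff, Polynomial.coeff_monomial]
  have hPdeg : P.natDegree ≤ d := by
    rw [Polynomial.natDegree_le_iff_coeff_eq_zero]
    intro N hN
    rw [hcoeff, if_neg (by simp; omega)]
  suffices hP0 : P = 0 by
    intro j hj
    have := hcoeff j
    rwa [hP0, if_pos hj, Polynomial.coeff_zero, eq_comm] at this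
  by_contra hP0
  set I := Finset.univ.filter (fun i => (l i).2 ≠ 0) with hI
  have hinj : Set.InjOn (fun i => (l i).1 / (l i).2) I := by
    intro i hi j hj hij
    have hi2 : (l i).2 ≠ 0 := (Finset.mem_filter.1 hi).2
    have hj2 : (l j).2 ≠ 0 := (Finset.mem_filter.1 hj).2
    by_contra hne
    apply hl i j hne
    simp only at hij
    rw [div_eq_div_iff hi2 hj2] at hij
    linear_combination hij
  have hd0 : (d : ℂ) ≠ 0 := by exact_mod_cast (by omega : d ≠ 0)
  have key := two_mul_card_le_natDegree hP0 (I.image fun i => (l i).1 / (l i).2)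
    (by
      intro t ht
      obtain ⟨i, hi, rfl⟩ := Finset.mem_image.1 ht
      have hi2 : (l i).2 ≠ 0 := (Finset.mem_filter.1 hi).2
      have e : (d : ℂ) * (l i).2 ^ d * P.eval ((l i).1 / (l i).2) =
          (l i).1 * (∑ j ∈ Finset.range (d + 1),
            c j * (j * (l i).1 ^ (j - 1) * (l i).2 ^ (d - j))) +
          (l i).2 * ∑ j ∈ Finset.range (d + 1),
            c j * ((l i).1 ^ j * ((d - j : ℕ) * (l i).2 ^ (d - j - 1))) := by
        rw [hP, Polynomial.eval_finsetSum, Finset.mul_sum, Finset.mul_sum, Finset.mul_sum,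
          ← Finset.sum_add_distrib]
        refine Finset.sum_congr rfl fun j hj => ?_
        obtain ⟨k, rfl⟩ := Nat.exists_eq_add_of_le (Nat.lt_succ_iff.1 (Finset.mem_range.1 hj))
        have ej : ∀ (n : ℕ) (z : ℂ), z * (n * z ^ (n - 1)) = n * z ^ n := by
          intro n z
          cases n with
          | zero => simp
          | succ n => simp only [add_tsub_cancel_right]; ring
        have e1 := ej j (l i).1
        have e2 := ej k (l i).2
        rw [Polynomial.eval_monomial, add_tsub_cancel_left, div_pow, pow_add]
        field_simp
        push_cast
        linear_combination (-c j * (l i).2 ^ k) * e1 - (c j * (l i).1 ^ j) * e2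
      rw [h1, h2, mul_zero, mul_zero, add_zero] at e
      exact (mul_eq_zero.1 e).resolve_left (mul_ne_zero hd0 (pow_ne_zero _ hi2)))
    (by
      intro t ht
      obtain ⟨i, hi, rfl⟩ := Finset.mem_image.1 ht
      have hi2 : (l i).2 ≠ 0 := (Finset.mem_filter.1 hi).2
      have e : (l i).2 ^ (d - 1) * P.derivative.eval ((l i).1 / (l i).2) =
          ∑ j ∈ Finset.range (d + 1), c j * (j * (l i).1 ^ (j - 1) * (l i).2 ^ (d - j)) := by
        rw [hP, Polynomial.derivative_sum, Polynomial.eval_finsetSum, Finset.mul_sum]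
        refine Finset.sum_congr rfl fun j hj => ?_
        have hj := Finset.mem_range.1 hj
        rw [Polynomial.derivative_monomial, Polynomial.eval_monomial]
        cases j with
        | zero => simp
        | succ j =>
          rw [show d - 1 = j + (d - (j + 1)) by omega, pow_add, add_tsub_cancel_right, div_pow]
          field_simp
      rw [h1] at e
      exact (mul_eq_zero.1 e).resolve_left (pow_ne_zero _ hi2))
  rw [Finset.card_image_of_injOn hinj] at key
  by_cases hall : ∀ i, (l i).2 ≠ 0
  · rw [hI, Finset.filter_true_of_mem (fun i _ => hall i), Finset.card_univ,
      Fintype.card_fin] at key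
    omega
  · push Not at hall
    obtain ⟨i₀, hi₀⟩ := hall
    have ha : (l i₀).1 ≠ 0 := fun h => hl0 i₀ (Prod.ext h hi₀)
    have hIcard : r ≤ I.card + 1 := by
      have : Finset.univ ⊆ insert i₀ I := by
        intro i _
        rw [Finset.mem_insert]
        by_contra hcon
        push Not at hcon
        have h2 : (l i).2 = 0 := by
          by_contra h2
          exact hcon.2 (Finset.mem_filter.2 ⟨Finset.mem_univ _, h2⟩)
        exact hl i i₀ hcon.1 (by simp [h2, hi₀])
      have h := (Finset.card_le_card this).trans (Finset.card_insert_le _ _)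
      simpa using h
    have hcd : c d = 0 := by
      have h := h1 i₀
      rw [Finset.sum_eq_single_of_mem d (by simp)] at h
      · simpa [hd0, ha] using h
      · intro j hj hjd
        have := Finset.mem_range.1 hj
        rw [hi₀, zero_pow (by omega)]
        simp
    have hcd1 : c (d - 1) = 0 := by
      have h := h2 i₀
      rw [Finset.sum_eq_single_of_mem (d - 1) (by simp)] at h
      · rw [show d - (d - 1) = 1 by omega] at h
        simpa [ha] using h
      · intro j hj hjd
        have := Finset.mem_range.1 hj
        by_cases hjd' : j = d
        · simp [hjd']
        · rw [hi₀, zero_pow (by omega)]; simp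
    have hPdeg2 : P.natDegree ≤ d - 2 := by
      rw [Polynomial.natDegree_le_iff_coeff_eq_zero]
      intro N hN
      rw [hcoeff]
      split_ifs with hN'
      · have := Finset.mem_range.1 hN'
        obtain rfl | rfl : N = d ∨ N = d - 1 := by omega
        · exact hcd
        · exact hcd1
      · rfl
    omega

/-- Near a sum of powers of pairwise non-proportional linear forms, with enough summands, every
coefficient vector is again one of such a sum of powers. -/
theorem range_powerSum_mem_nhds {d r : ℕ} (hd : 2 ≤ d) (hr : d < 2 * r) (l : Fin r → ℂ × ℂ)
    (hl0 : ∀ i, l i ≠ 0)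
    (hl : ∀ i j, i ≠ j → (l i).1 * (l j).2 - (l i).2 * (l j).1 ≠ 0) :
    Set.range (fun (m : Fin r → ℂ × ℂ) (j : Fin (d + 1)) =>
      ∑ i, (m i).1 ^ (j : ℕ) * (m i).2 ^ (d - j)) ∈
      nhds fun j : Fin (d + 1) => ∑ i, (l i).1 ^ (j : ℕ) * (l i).2 ^ (d - j) := by
  classical
  set A : Fin r → (Fin r → ℂ × ℂ) →L[ℂ] ℂ := fun i =>
    (ContinuousLinearMap.fst ℂ ℂ ℂ).comp (ContinuousLinearMap.proj i) with hA
  set B : Fin r → (Fin r → ℂ × ℂ) →L[ℂ] ℂ := fun i =>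
    (ContinuousLinearMap.snd ℂ ℂ ℂ).comp (ContinuousLinearMap.proj i) with hB
  set D : (Fin r → ℂ × ℂ) →L[ℂ] (Fin (d + 1) → ℂ) := ContinuousLinearMap.pi fun j =>
    ∑ i, ((j * (l i).1 ^ ((j : ℕ) - 1) * (l i).2 ^ (d - j)) • A i +
      ((l i).1 ^ (j : ℕ) * ((d - j : ℕ) * (l i).2 ^ (d - j - 1))) • B i) with hD
  have hder : HasStrictFDerivAt (fun (m : Fin r → ℂ × ℂ) (j : Fin (d + 1)) =>
      ∑ i, (m i).1 ^ (j : ℕ) * (m i).2 ^ (d - j)) D l := by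
    refine hasStrictFDerivAt_pi.2 fun j => ?_
    refine HasStrictFDerivAt.fun_sum fun i _ => ?_
    have h := ((A i).hasStrictFDerivAt (x := l)).pow (j : ℕ) |>.mul
      (((B i).hasStrictFDerivAt (x := l)).pow (d - j))
    refine h.congr_fderiv ?_
    ext v
    simp [hA, hB]
    ring
  have hsurj : D.range = ⊤ := by
    by_contra hne
    obtain ⟨f, hf0, hf⟩ := Submodule.exists_le_ker_of_lt_top _ (lt_top_iff_ne_top.2 hne)
    apply hf0
    have hfsum : ∀ w : Fin (d + 1) → ℂ, f w = ∑ j, f (Pi.single j 1) * w j := by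
      intro w
      conv_lhs => rw [pi_eq_sum_univ' w]
      rw [map_sum]
      refine Finset.sum_congr rfl fun j _ => ?_
      rw [map_smul, smul_eq_mul, mul_comm]
    have hfD : ∀ v, f (D v) = 0 := fun v => hf ⟨v, rfl⟩
    set c : ℕ → ℂ := fun j => if h : j < d + 1 then f (Pi.single ⟨j, h⟩ 1) else 0 with hc
    have hcf : ∀ j : Fin (d + 1), c j = f (Pi.single j 1) := fun j => by
      rw [hc]
      exact dif_pos j.2
    have hDv : ∀ i (z : ℂ × ℂ) (j : Fin (d + 1)), D (Pi.single i z) j =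
        (j * (l i).1 ^ ((j : ℕ) - 1) * (l i).2 ^ (d - j)) * z.1 +
        ((l i).1 ^ (j : ℕ) * ((d - j : ℕ) * (l i).2 ^ (d - j - 1))) * z.2 := by
      intro i z j
      simp only [hD, hA, hB, ContinuousLinearMap.coe_pi', sum_apply,
        add_apply, smul_apply,
        ContinuousLinearMap.comp_apply, ContinuousLinearMap.proj_apply,
        ContinuousLinearMap.coe_fst', ContinuousLinearMap.coe_snd', smul_eq_mul]
      rw [Finset.sum_eq_single_of_mem i (Finset.mem_univ i)]
      · simp
      · intro k _ hk
        simp [Pi.single_eq_of_ne hk]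
    have hc0 := eq_zero_of_singular hd hr l hl0 hl c
      (fun i => by
        have h := hfD (Pi.single i (1, 0))
        rw [hfsum] at h
        rw [Finset.sum_range, ← h]
        refine Finset.sum_congr rfl fun j _ => ?_
        rw [hDv, hcf]
        simp)
      (fun i => by
        have h := hfD (Pi.single i (0, 1))
        rw [hfsum] at h
        rw [Finset.sum_range, ← h]
        refine Finset.sum_congr rfl fun j _ => ?_
        rw [hDv, hcf]
        simp)
    ext j
    simpa [← hcf] using hc0 j (Finset.mem_range.2 j.2)
  rw [← hder.map_nhds_eq_of_surj hsurj]
  exact Filter.range_mem_map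

theorem exists_cWaringRank_add_smul_le {d r : ℕ} (hd : 2 ≤ d) (hr : d < 2 * r) (hr2 : 2 ≤ r)
    {p F : MvPolynomial (Fin 2) ℂ} (hp : cWaringRank d p = r) (hF : F.IsHomogeneous d) :
    ∃ μ : ℂ, cWaringRank d (F + μ • p) ≤ r := by
  obtain ⟨l, hl⟩ := exists_of_cWaringRank_eq hp
  have hcross := fun i j (hij : i ≠ j) =>
    cross_ne_zero_of_cWaringRank_eq (by omega) hp hl hij
  have hl0 : ∀ i, l i ≠ 0 := by
    intro i hi
    have : Nontrivial (Fin r) := Fin.nontrivial_iff_two_le.2 hr2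
    obtain ⟨j, hj⟩ := exists_ne i
    exact hcross i j hj.symm (by simp [hi])
  obtain ⟨c, hc⟩ := exists_eval_eq_sum_choose hF
  have hnhds := range_powerSum_mem_nhds hd hr l hl0 hcross
  have hcont : Continuous fun (ε : ℂ) (j : Fin (d + 1)) =>
      ∑ i, (l i).1 ^ (j : ℕ) * (l i).2 ^ (d - j) + ε * c j := by fun_prop
  have hev := (hcont.tendsto' 0 _ (by simp)).eventually hnhds
  obtain ⟨ε, ⟨m, hm⟩, hε⟩ :=
    ((hev.filter_mono nhdsWithin_le_nhds).and (self_mem_nhdsWithin (s := ({0}ᶜ : Set ℂ)))).exists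
  replace hε : ε ≠ 0 := hε
  obtain ⟨ζ, hζ⟩ := IsAlgClosed.exists_pow_nat_eq ε⁻¹ (show 0 < d by omega)
  refine ⟨ε⁻¹, ?_⟩
  have h := cWaringRank_le_card (d := d) (Finset.univ : Finset (Fin r)) (fun i => ζ • m i)
    (F := F + ε⁻¹ • p) ?_
  · simpa using h
  refine MvPolynomial.funext fun v => ?_
  have hsum : ∀ k : Fin r → ℂ × ℂ,
      eval v (∑ i, (C (k i).1 * X 0 + C (k i).2 * X 1) ^ d) =
      ∑ j ∈ Finset.range (d + 1), (∑ i, (k i).1 ^ j * (k i).2 ^ (d - j)) *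
        (d.choose j * (v 0 ^ j * v 1 ^ (d - j))) := by
    intro k
    rw [map_sum]
    simp only [eval_linear_pow, Finset.sum_mul]
    rw [Finset.sum_comm]
  rw [map_add, smul_eval, hc, hl, hsum, hsum, Finset.mul_sum, ← Finset.sum_add_distrib]
  refine Finset.sum_congr rfl fun j hj => ?_
  have hmj := congrFun hm ⟨j, Finset.mem_range.1 hj⟩
  simp only at hmj
  have hζm : ∑ i, (ζ • m i).1 ^ j * (ζ • m i).2 ^ (d - j) =
      ε⁻¹ * ∑ i, (m i).1 ^ j * (m i).2 ^ (d - j) := by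
    rw [← hζ, Finset.mul_sum]
    refine Finset.sum_congr rfl fun i _ => ?_
    have : ζ ^ d = ζ ^ j * ζ ^ (d - j) := by
      rw [← pow_add, Nat.add_sub_cancel' (Nat.lt_succ_iff.1 (Finset.mem_range.1 hj))]
    rw [this, Prod.smul_fst, Prod.smul_snd, smul_eq_mul, smul_eq_mul, mul_pow, mul_pow]
    ring
  rw [hζm, hmj]
  field_simp
  ring

theorem le_waringRank_of_zeros {d : ℕ} {f : MvPolynomial (Fin 2) ℝ} (S : Finset (ℝ × ℝ))
    (hS : d ≤ S.card) (hind : ∀ v ∈ S, ∀ w ∈ S, v ≠ w → v.1 * w.2 - v.2 * w.1 ≠ 0)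
    (hz : ∀ v ∈ S, eval ![v.1, v.2] f = 0) {x y : ℝ} (hxy : eval ![x, y] f ≠ 0) :
    (d : ℕ∞) ≤ waringRank d f := by
  refine le_sInf ?_
  rintro _ ⟨r, ⟨lam, l, hf⟩, rfl⟩
  by_contra hlt
  have hlt' : r < d := by
    have : (r : ℕ∞) < d := not_le.1 hlt
    exact_mod_cast this
  have heval : ∀ x y, eval ![x, y] f = ∑ i, lam i * ((l i).1 * x + (l i).2 * y) ^ d := by
    intro x y
    simp [hf]
  refine hxy ((heval x y).trans (powerSum_eq_zero hlt' lam (fun i => (l i).1)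
    (fun i => (l i).2) S hS hind (fun v hv => ?_) x y))
  rw [← heval, hz v hv]

theorem eval_smul_of_isHomogeneous {d : ℕ} {f : MvPolynomial (Fin 2) ℝ}
    (hf : f.IsHomogeneous d) (t x y : ℝ) :
    eval ![t * x, t * y] f = t ^ d * eval ![x, y] f := by
  obtain ⟨c, hc⟩ := exists_eval_eq_sum_choose hf
  rw [hc, hc, Finset.mul_sum]
  refine Finset.sum_congr rfl fun j hj => ?_
  have : t ^ d = t ^ j * t ^ (d - j) := by
    rw [← pow_add, Nat.add_sub_cancel' (Nat.lt_succ_iff.1 (Finset.mem_range.1 hj))]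
  simp only [Matrix.cons_val_zero, Matrix.cons_val_one, mul_pow, this]
  ring

theorem cross_ne_zero_of_not_smul {u v : ℝ × ℝ} (huv : ¬ ∃ t : ℝ, u = t • v)
    (hvu : ¬ ∃ t : ℝ, v = t • u) : u.1 * v.2 - u.2 * v.1 ≠ 0 := by
  intro h
  by_cases h1 : v.1 = 0
  · by_cases h2 : v.2 = 0
    · exact hvu ⟨0, by ext <;> simp [h1, h2]⟩
    · refine huv ⟨u.2 / v.2, Prod.ext ?_ ?_⟩
      · simp only [h1, mul_zero, sub_zero, mul_eq_zero, h2, or_false] at h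
        simp [h1, h]
      · simp [h2]
  · refine huv ⟨u.1 / v.1, Prod.ext ?_ ?_⟩
    · simp [h1]
    · simp only [Prod.smul_snd, smul_eq_mul]
      field_simp
      linarith

/-- The angle in `(-π/2, π/2]` of the zero of the linear form `a x + b y`. -/
noncomputable def zeroAngle (u : ℝ × ℝ) : ℝ :=
  if u.2 = 0 then Real.pi / 2 else Real.arctan (-u.1 / u.2)

theorem zeroAngle_le (u : ℝ × ℝ) : zeroAngle u ≤ Real.pi / 2 := by
  unfold zeroAngle
  split_ifs
  · exact le_rfl
  · exact (Real.arctan_lt_pi_div_two _).le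

theorem neg_pi_div_two_lt_zeroAngle (u : ℝ × ℝ) : -(Real.pi / 2) < zeroAngle u := by
  unfold zeroAngle
  split_ifs
  · linarith [Real.pi_pos]
  · exact Real.neg_pi_div_two_lt_arctan _

theorem linear_zeroAngle (u : ℝ × ℝ) :
    u.1 * Real.cos (zeroAngle u) + u.2 * Real.sin (zeroAngle u) = 0 := by
  unfold zeroAngle
  split_ifs with h
  · simp [h]
  · rw [Real.sin_arctan, Real.cos_arctan]
    field_simp
    ring

theorem eq_zeroAngle {u : ℝ × ℝ} (hu : u ≠ 0) {θ : ℝ} (h1 : -(Real.pi / 2) < θ)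
    (h2 : θ < Real.pi / 2) (h : u.1 * Real.cos θ + u.2 * Real.sin θ = 0) :
    θ = zeroAngle u := by
  have hcos : Real.cos θ ≠ 0 := (Real.cos_pos_of_mem_Ioo ⟨h1, h2⟩).ne'
  have hu2 : u.2 ≠ 0 := by
    intro h0
    simp only [h0, zero_mul, add_zero, mul_eq_zero, hcos, or_false] at h
    exact hu (Prod.ext h h0)
  have htan : Real.tan θ = -u.1 / u.2 := by
    rw [Real.tan_eq_sin_div_cos, div_eq_div_iff hcos hu2]
    linarith
  rw [zeroAngle, if_neg hu2, ← htan, Real.arctan_tan h1 h2]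

theorem isHomogeneous_linear (a b : ℝ) :
    (C a * X 0 + C b * X 1 : MvPolynomial (Fin 2) ℝ).IsHomogeneous 1 :=
  ((isHomogeneous_X ℝ 0).C_mul a).add ((isHomogeneous_X ℝ 1).C_mul b)

/-- The derivative of `∏ i, ℓᵢ` along the rotation field `x ∂/∂y - y ∂/∂x`. -/
noncomputable def rotationDeriv {d : ℕ} (l : Fin d → ℝ × ℝ) : MvPolynomial (Fin 2) ℝ :=
  ∑ i, (∏ j ∈ Finset.univ.erase i, (C (l j).1 * X 0 + C (l j).2 * X 1)) *
    (C (l i).2 * X 0 + C (-(l i).1) * X 1)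

theorem isHomogeneous_prod_linear {d : ℕ} (l : Fin d → ℝ × ℝ) :
    (∏ i, (C (l i).1 * X 0 + C (l i).2 * X 1) : MvPolynomial (Fin 2) ℝ).IsHomogeneous d := by
  simpa using IsHomogeneous.prod Finset.univ _ (fun _ : Fin d => 1)
    fun i _ => isHomogeneous_linear (l i).1 (l i).2

theorem isHomogeneous_rotationDeriv {d : ℕ} (l : Fin d → ℝ × ℝ) :
    (rotationDeriv l).IsHomogeneous d := by
  refine IsHomogeneous.sum _ _ _ fun i _ => ?_
  have h := (IsHomogeneous.prod (Finset.univ.erase i) _ (fun _ : Fin d => 1)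
    fun j _ => isHomogeneous_linear (l j).1 (l j).2).mul
      (isHomogeneous_linear (l i).2 (-(l i).1))
  have hd : d - 1 + 1 = d := by have := i.pos; omega
  simpa [hd] using h

theorem hasDerivAt_exp_mul_prod_linear {d : ℕ} (l : Fin d → ℝ × ℝ) (μ θ : ℝ) :
    HasDerivAt (fun θ => Real.exp (μ * θ) *
      ∏ i, ((l i).1 * Real.cos θ + (l i).2 * Real.sin θ))
      (Real.exp (μ * θ) * eval ![Real.cos θ, Real.sin θ]
        (rotationDeriv l + μ • ∏ i, (C (l i).1 * X 0 + C (l i).2 * X 1))) θ := by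
  have h1 : HasDerivAt (fun θ => ∏ i, ((l i).1 * Real.cos θ + (l i).2 * Real.sin θ)) _ θ :=
    HasDerivAt.fun_finsetProd (u := Finset.univ) fun i _ =>
      ((Real.hasDerivAt_cos θ).const_mul (l i).1).add ((Real.hasDerivAt_sin θ).const_mul (l i).2)
  have h2 := ((hasDerivAt_id θ).const_mul μ).exp
  refine (h2.mul h1).congr_deriv ?_
  simp only [rotationDeriv, map_add, map_sum, map_mul, map_prod, eval_C, eval_X, smul_eval,
    Matrix.cons_val_zero, Matrix.cons_val_one, id, smul_eq_mul]
  have : ∀ i, (l i).1 * -Real.sin θ + (l i).2 * Real.cos θ =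
    (l i).2 * Real.cos θ + -(l i).1 * Real.sin θ := fun i => by ring
  simp only [this]
  ring

section Pencil

variable {d : ℕ} {l : Fin d → ℝ × ℝ}

theorem zeroAngle_injective
    (hl : ∀ i j, i ≠ j → (l i).1 * (l j).2 - (l i).2 * (l j).1 ≠ 0) :
    Function.Injective fun i => zeroAngle (l i) := by
  intro i j hij
  by_contra hne
  have h1 := linear_zeroAngle (l i)
  have h2 := linear_zeroAngle (l j)
  simp only at hij
  rw [← hij] at h2
  have hc := hl i j hne
  have hcs := Real.cos_sq_add_sin_sq (zeroAngle (l i))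
  set x := Real.cos (zeroAngle (l i))
  set y := Real.sin (zeroAngle (l i))
  have hx : ((l i).1 * (l j).2 - (l i).2 * (l j).1) * x = 0 := by
    linear_combination (l j).2 * h1 - (l i).2 * h2
  have hy : ((l i).1 * (l j).2 - (l i).2 * (l j).1) * y = 0 := by
    linear_combination (l i).1 * h2 - (l j).1 * h1
  have hx := (mul_eq_zero.1 hx).resolve_left hc
  have hy := (mul_eq_zero.1 hy).resolve_left hc
  simp [hx, hy] at hcs

/-- Any member of the pencil other than `∏ i, ℓᵢ` has `d` pairwise non-proportional zeros. -/
theorem exists_zeros_pencil (hd : 0 < d)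
    (hl : ∀ i j, i ≠ j → (l i).1 * (l j).2 - (l i).2 * (l j).1 ≠ 0) (μ : ℝ) :
    ∃ S : Finset (ℝ × ℝ), d ≤ S.card ∧
      (∀ v ∈ S, ∀ w ∈ S, v ≠ w → v.1 * w.2 - v.2 * w.1 ≠ 0) ∧
      ∀ v ∈ S, eval ![v.1, v.2]
        (rotationDeriv l + μ • ∏ i, (C (l i).1 * X 0 + C (l i).2 * X 1)) = 0 := by
  classical
  set T := Finset.univ.image fun i => zeroAngle (l i) with hT
  have hTcard : T.card = d := by
    rw [hT, Finset.card_image_of_injective _ (zeroAngle_injective hl)]; simp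
  have hTne : T.Nonempty := Finset.card_pos.1 (by omega)
  set m := T.min' hTne with hm
  have hTmem : ∀ t ∈ T, ∃ i, zeroAngle (l i) = t := by
    intro t ht
    obtain ⟨i, -, hi⟩ := Finset.mem_image.1 ht
    exact ⟨i, hi⟩
  obtain ⟨i₀, hi₀⟩ := hTmem m (T.min'_mem hTne)
  have hlt : ∀ t ∈ T, t < m + Real.pi := by
    intro t ht
    obtain ⟨i, rfl⟩ := hTmem t ht
    have h1 := zeroAngle_le (l i)
    have h2 := neg_pi_div_two_lt_zeroAngle (l i₀)
    linarith
  have hnot : m + Real.pi ∉ T := fun h => lt_irrefl _ (hlt _ h)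
  obtain ⟨U, hU, hU'⟩ := exists_finset_deriv_eq_zero (hasDerivAt_exp_mul_prod_linear l μ)
    (insert (m + Real.pi) T) (by
      intro t ht
      refine mul_eq_zero_of_right _ ?_
      rcases Finset.mem_insert.1 ht with rfl | ht
      · refine Finset.prod_eq_zero (Finset.mem_univ i₀) ?_
        rw [Real.cos_add_pi, Real.sin_add_pi, ← hi₀]
        linarith [linear_zeroAngle (l i₀)]
      · obtain ⟨i, rfl⟩ := hTmem t ht
        exact Finset.prod_eq_zero (Finset.mem_univ i) (linear_zeroAngle (l i)))
  rw [Finset.card_insert_of_notMem hnot, hTcard] at hU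
  have hUI : ∀ u ∈ U, m < u ∧ u < m + Real.pi := by
    intro u hu
    obtain ⟨-, ⟨t, ht, htu⟩, ⟨t', ht', htu'⟩⟩ := hU' u hu
    constructor
    · refine lt_of_le_of_lt ?_ htu
      rcases Finset.mem_insert.1 ht with rfl | ht
      · linarith [Real.pi_pos]
      · exact T.min'_le _ ht
    · refine htu'.trans_le ?_
      rcases Finset.mem_insert.1 ht' with rfl | ht'
      · exact le_rfl
      · exact (hlt _ ht').le
  have hcross : ∀ u ∈ U, ∀ u' ∈ U, u ≠ u' →
      Real.cos u * Real.sin u' - Real.sin u * Real.cos u' ≠ 0 := by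
    intro u hu u' hu' hne h
    have hs : Real.sin (u' - u) = 0 := by rw [Real.sin_sub]; linarith
    have h1 := hUI u hu
    have h2 := hUI u' hu'
    rw [Real.sin_eq_zero_iff_of_lt_of_lt (by linarith) (by linarith)] at hs
    exact hne (by linarith)
  have hinj : Set.InjOn (fun u => (Real.cos u, Real.sin u)) U := by
    intro u hu u' hu' h
    by_contra hne
    obtain ⟨h1, h2⟩ := Prod.mk.inj h
    exact hcross u hu u' hu' hne (by rw [h1, h2]; ring)
  refine ⟨U.image fun u => (Real.cos u, Real.sin u), ?_, ?_, ?_⟩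
  · rw [Finset.card_image_of_injOn hinj]; omega
  · intro v hv w hw hvw
    obtain ⟨u, hu, rfl⟩ := Finset.mem_image.1 hv
    obtain ⟨u', hu', rfl⟩ := Finset.mem_image.1 hw
    exact hcross u hu u' hu' fun h => hvw (by rw [h])
  · intro v hv
    obtain ⟨u, hu, rfl⟩ := Finset.mem_image.1 hv
    exact (mul_eq_zero.1 (hU' u hu).1).resolve_left (Real.exp_ne_zero _)

theorem not_monotoneOn_or_antitoneOn (hd : 3 ≤ d)
    (hl : ∀ i j, i ≠ j → (l i).1 * (l j).2 - (l i).2 * (l j).1 ≠ 0) (hl0 : ∀ i, l i ≠ 0)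
    (μ : ℝ) {G : ℝ → ℝ} (hG : G = fun θ => Real.exp (μ * θ) *
      ∏ i, ((l i).1 * Real.cos θ + (l i).2 * Real.sin θ)) :
    ¬ (MonotoneOn G (Set.Ioo (-(Real.pi / 2)) (Real.pi / 2)) ∨
      AntitoneOn G (Set.Ioo (-(Real.pi / 2)) (Real.pi / 2))) := by
  classical
  intro hmono
  set T := Finset.univ.image fun i => zeroAngle (l i) with hT
  have hTcard : T.card = d := by
    rw [hT, Finset.card_image_of_injective _ (zeroAngle_injective hl)]; simp
  have hzero : ∀ t ∈ T, G t = 0 := by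
    intro t ht
    obtain ⟨i, -, rfl⟩ := Finset.mem_image.1 ht
    rw [hG]
    exact mul_eq_zero_of_right _ (Finset.prod_eq_zero (Finset.mem_univ i) (linear_zeroAngle (l i)))
  have hcard : 1 < (T.erase (Real.pi / 2)).card := by
    have := Finset.pred_card_le_card_erase (s := T) (a := Real.pi / 2)
    omega
  obtain ⟨s, hs, t, ht, hst⟩ : ∃ s ∈ T.erase (Real.pi / 2), ∃ t ∈ T.erase (Real.pi / 2),
      s < t := by
    obtain ⟨s, hs, t, ht, hst⟩ := Finset.one_lt_card.1 hcard
    rcases lt_or_gt_of_ne hst with h | h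
    · exact ⟨s, hs, t, ht, h⟩
    · exact ⟨t, ht, s, hs, h⟩
  have hIoo : ∀ t ∈ T.erase (Real.pi / 2), t ∈ Set.Ioo (-(Real.pi / 2)) (Real.pi / 2) := by
    intro t ht
    obtain ⟨hne, ht⟩ := Finset.mem_erase.1 ht
    obtain ⟨i, -, rfl⟩ := Finset.mem_image.1 ht
    exact ⟨neg_pi_div_two_lt_zeroAngle _, lt_of_le_of_ne (zeroAngle_le _) hne⟩
  have hs0 := hzero s (Finset.mem_of_mem_erase hs)
  have ht0 := hzero t (Finset.mem_of_mem_erase ht)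
  refine (Set.Icc_infinite hst) (T.finite_toSet.subset fun θ hθ => ?_)
  have hθI : θ ∈ Set.Ioo (-(Real.pi / 2)) (Real.pi / 2) :=
    ⟨(hIoo s hs).1.trans_le hθ.1, hθ.2.trans_lt (hIoo t ht).2⟩
  have hGθ : G θ = 0 := by
    rcases hmono with h | h
    · have h1 := h (hIoo s hs) hθI hθ.1
      have h2 := h hθI (hIoo t ht) hθ.2
      linarith
    · have h1 := h (hIoo s hs) hθI hθ.1
      have h2 := h hθI (hIoo t ht) hθ.2
      linarith
  rw [hG] at hGθ
  have hprod := (mul_eq_zero.1 hGθ).resolve_left (Real.exp_ne_zero _)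
  obtain ⟨i, -, hi⟩ := Finset.prod_eq_zero_iff.1 hprod
  rw [eq_zeroAngle (hl0 i) hθI.1 hθI.2 hi]
  exact Finset.mem_coe.2 (Finset.mem_image_of_mem _ (Finset.mem_univ i))

theorem indefinite_pencil (hd : 3 ≤ d)
    (hl : ∀ i j, i ≠ j → (l i).1 * (l j).2 - (l i).2 * (l j).1 ≠ 0) (hl0 : ∀ i, l i ≠ 0)
    (μ : ℝ) {f : MvPolynomial (Fin 2) ℝ} (hf : f.IsHomogeneous d)
    (hfl : f = rotationDeriv l + μ • ∏ i, (C (l i).1 * X 0 + C (l i).2 * X 1)) :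
    (∃ s, 0 < eval ![1, s] f) ∧ ∃ t, eval ![1, t] f < 0 := by
  have hder := hasDerivAt_exp_mul_prod_linear l μ
  rw [← hfl] at hder
  have hcont : ContinuousOn (fun θ => Real.exp (μ * θ) *
      ∏ i, ((l i).1 * Real.cos θ + (l i).2 * Real.sin θ))
      (Set.Ioo (-(Real.pi / 2)) (Real.pi / 2)) :=
    fun θ _ => (hder θ).continuousAt.continuousWithinAt
  have hchart : ∀ θ ∈ Set.Ioo (-(Real.pi / 2)) (Real.pi / 2), 0 < Real.cos θ ^ d ∧
      eval ![Real.cos θ, Real.sin θ] f = Real.cos θ ^ d * eval ![1, Real.tan θ] f := by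
    intro θ hθ
    have hcos := Real.cos_pos_of_mem_Ioo hθ
    refine ⟨pow_pos hcos d, ?_⟩
    rw [← eval_smul_of_isHomogeneous hf, mul_one, mul_comm, Real.tan_mul_cos hcos.ne']
  have hnot := not_monotoneOn_or_antitoneOn hd hl hl0 μ rfl
  constructor
  · by_contra! hcon
    refine hnot (Or.inr (antitoneOn_of_hasDerivWithinAt_nonpos (convex_Ioo _ _) hcont
      (fun θ _ => (hder θ).hasDerivWithinAt) fun θ hθ => ?_))
    rw [interior_Ioo] at hθ
    obtain ⟨h1, h2⟩ := hchart θ hθ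
    rw [h2]
    exact mul_nonpos_of_nonneg_of_nonpos (Real.exp_pos _).le
      (mul_nonpos_of_nonneg_of_nonpos h1.le (hcon _))
  · by_contra! hcon
    refine hnot (Or.inl (monotoneOn_of_hasDerivWithinAt_nonneg (convex_Ioo _ _) hcont
      (fun θ _ => (hder θ).hasDerivWithinAt) fun θ hθ => ?_))
    rw [interior_Ioo] at hθ
    obtain ⟨h1, h2⟩ := hchart θ hθ
    rw [h2]
    exact mul_nonneg (Real.exp_pos _).le (mul_nonneg h1.le (hcon _))

end Pencil

/-- Let `p` be a degree-`d ≥ 3` product of pairwise non-proportional real linear forms whose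
complex Waring rank is `⌈(d+1)/2⌉`. Then (i) every complex binary form `F ∉ ℂ·p` of degree `d`
has complex rank at most `⌈(d+1)/2⌉` with respect to the projection of the rational normal
curve from `p`, whereas (ii) there is a real binary form `q ∉ ℝ·p` of degree `d` whose real
rank with respect to this projection is `d`. -/
theorem statement14 (d : ℕ) (hd : 3 ≤ d) (l : Fin d → ℝ × ℝ)
    (hdist : ∀ i j, i ≠ j → ¬ ∃ t : ℝ, l i = t • l j)
    (p : MvPolynomial (Fin 2) ℝ)
    (hp : p = ∏ i, (C (l i).1 * X 0 + C (l i).2 * X 1))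
    (hcrank : cWaringRank d (MvPolynomial.map (algebraMap ℝ ℂ) p) = ((d + 2) / 2 : ℕ)) :
    (∀ F : MvPolynomial (Fin 2) ℂ, F.IsHomogeneous d →
      (¬ ∃ μ : ℂ, F = μ • MvPolynomial.map (algebraMap ℝ ℂ) p) →
      ∃ μ : ℂ, cWaringRank d (F + μ • MvPolynomial.map (algebraMap ℝ ℂ) p) ≤
        ((d + 2) / 2 : ℕ)) ∧
    ∃ q : MvPolynomial (Fin 2) ℝ, q.IsHomogeneous d ∧ (¬ ∃ μ : ℝ, q = μ • p) ∧
      ∀ μ : ℝ, waringRank d (q + μ • p) = (d : ℕ) := by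
  refine ⟨fun F hF _ =>
    exists_cWaringRank_add_smul_le (by omega) (by omega) (by omega) hcrank hF, ?_⟩
  have hl : ∀ i j, i ≠ j → (l i).1 * (l j).2 - (l i).2 * (l j).1 ≠ 0 := fun i j hij =>
    cross_ne_zero_of_not_smul (hdist i j hij) (hdist j i hij.symm)
  have hl0 : ∀ i, l i ≠ 0 := by
    intro i hi
    have : Nontrivial (Fin d) := Fin.nontrivial_iff_two_le.2 (by omega)
    obtain ⟨j, hj⟩ := exists_ne i
    exact hl i j hj.symm (by simp [hi])
  have hhom : ∀ μ : ℝ, (rotationDeriv l + μ • p).IsHomogeneous d := by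
    intro μ
    rw [hp, smul_eq_C_mul]
    exact (isHomogeneous_rotationDeriv l).add ((isHomogeneous_prod_linear l).C_mul μ)
  have hindef := fun μ => indefinite_pencil hd hl hl0 μ (hhom μ) (by rw [hp])
  refine ⟨rotationDeriv l, isHomogeneous_rotationDeriv l, ?_, fun μ => ?_⟩
  · rintro ⟨μ, hμ⟩
    obtain ⟨⟨s, hs⟩, -⟩ := hindef (-μ)
    rw [hμ, neg_smul, add_neg_cancel, map_zero] at hs
    exact lt_irrefl _ hs
  · obtain ⟨⟨s, hs⟩, ⟨t, ht⟩⟩ := hindef μ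
    obtain ⟨S, hS, hind, hz⟩ := exists_zeros_pencil (by omega) hl μ
    rw [← hp] at hz
    exact le_antisymm (waringRank_le_of_indefinite (hhom μ) hs ht)
      (le_waringRank_of_zeros S hS hind hz hs.ne')
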